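/- Let $n \ge 2$ and $m \ge 1$ be integers with $n+m \ge 3$. There is a unique $k$-algebra homomorphism $\Phi : C_{n,m} \to B_{n+m}$ sending $a_{ij} \mapsto \bar{x}_{ij} - \bar{x}_{i,n+m}$ for all $i \ne j$ in $\{1,\dots,n\}$ and $p_i^{(r)} \mapsto \bar{x}_{i,n+r} - \bar{x}_{i,n+m}$ for all $i \in \{1,\dots,n\}$, $1 \le r \le m-1$ (where $\bar{x}_{ij}$ denotes the image of $x_{ij}$ in $B_{n+m}$). Moreover, $\Phi$ is injective, sends the degree-$a$ component of $C_{n,m}$ ($a \in \mathbb{N}^n$) into the degree-$(a,0,\dots,0)$ component of $B_{n+m}$, and its image is exactly the subalgebra $B_{n,m} \subset B_{n+m}$ equal to the sum of the graded components of $B_{n+m}$ whose degrees lie in $\mathbb{N}e_1 + \cdots + \mathbb{N}e_n$ (i.e., have last $m$ coordinates zero). -/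

import Mathlib

/-! # Setup

`Bring k N` is the ring `B_N`: the quotient of the polynomial ring over the field `k`
in variables `x i j` (ordered pairs `i ≠ j` in `Fin N`), graded by `deg (x i j) = e i`,
by the ideal generated by the quadrics
`(x i K - x i j)(x j K - x j i) - (x i L - x i j)(x j L - x j i)` (`i,j,K,L` pairwise
distinct) and the variables `x i (i+1)` (indices mod `N`).

`Cnm k n m` is the ring `C_{n,m}`: the quotient of the polynomial ring over `k` in
variables `a i j` (`i ≠ j` in `Fin n`) and `p i r` (`i : Fin n`, `r : Fin (m-1)`) by the
ideal generated by `a i l * a j l - a i j * a j l - a j i * a i l` (`i,j,l` pairwise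
distinct) and `p i r * p j r - a i j * p j r - a j i * p i r` (`i ≠ j`).
-/

/-- The variables `x_{ij}` (ordered pairs `i ≠ j`) of the polynomial ring `S_N`. -/
abbrev BVarT (N : ℕ) := {q : Fin N × Fin N // q.1 ≠ q.2}

/-- The variable `x_{ij}`. -/
noncomputable def xv (k : Type*) [Field k] {N : ℕ} (i j : Fin N) (h : i ≠ j) :
    MvPolynomial (BVarT N) k :=
  MvPolynomial.X (⟨(i, j), h⟩ : BVarT N)

/-- The cyclic successor `i + 1` (mod `N`) of an index `i`. -/
def nextIdx {N : ℕ} (i : Fin N) : Fin N := ⟨(i.val + 1) % N, Nat.mod_lt _ i.pos⟩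

/-- The defining relations of `B_N`: the quadrics and the variables `x i (i+1)`
(indices mod `N`). -/
def Brels (k : Type*) [Field k] (N : ℕ) : Set (MvPolynomial (BVarT N) k) :=
  {f | ∃ (i j K L : Fin N) (hij : i ≠ j) (hiK : i ≠ K) (hiL : i ≠ L)
        (hjK : j ≠ K) (hjL : j ≠ L) (_ : K ≠ L),
      f = (xv k i K hiK - xv k i j hij) * (xv k j K hjK - xv k j i hij.symm)
            - (xv k i L hiL - xv k i j hij) * (xv k j L hjL - xv k j i hij.symm)} ∪
  {f | ∃ (i : Fin N) (h : i ≠ nextIdx i), f = xv k i (nextIdx i) h}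

/-- The ring `B_N`. -/
abbrev Bring (k : Type*) [Field k] (N : ℕ) :=
  MvPolynomial (BVarT N) k ⧸ Ideal.span (Brels k N)

/-- The class of `x_{ij}` in `B_N`. -/
noncomputable def xcl (k : Type*) [Field k] {N : ℕ} (i j : Fin N) (h : i ≠ j) :
    Bring k N :=
  Ideal.Quotient.mk (Ideal.span (Brels k N)) (xv k i j h)

/-- The weight function giving the `ℕ^N`-grading of `B_N`: `deg (x i j) = e i`. -/
def wB (N : ℕ) : BVarT N → (Fin N → ℕ) := fun q => Pi.single q.val.1 1

/-- The degree-`a` graded component of `B_N`. -/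
noncomputable def BComponent (k : Type*) [Field k] (N : ℕ) (a : Fin N → ℕ) :
    Submodule k (Bring k N) :=
  Submodule.map (Ideal.Quotient.mkₐ k (Ideal.span (Brels k N))).toLinearMap
    (MvPolynomial.weightedHomogeneousSubmodule k (wB N) a)

/-- The variables of the ring `C_{n,m}`. -/
abbrev CVarT (n m : ℕ) := {q : Fin n × Fin n // q.1 ≠ q.2} ⊕ (Fin n × Fin (m - 1))

/-- The variable `a_{ij}`. -/
noncomputable def av (k : Type*) [Field k] {n m : ℕ} (i j : Fin n) (h : i ≠ j) :
    MvPolynomial (CVarT n m) k :=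
  MvPolynomial.X (Sum.inl ⟨(i, j), h⟩)

/-- The variable `p_i^{(r)}`. -/
noncomputable def pv (k : Type*) [Field k] {n m : ℕ} (i : Fin n) (r : Fin (m - 1)) :
    MvPolynomial (CVarT n m) k :=
  MvPolynomial.X (Sum.inr (i, r))

/-- The defining relations of `C_{n,m}`. -/
def Crels (k : Type*) [Field k] (n m : ℕ) : Set (MvPolynomial (CVarT n m) k) :=
  {f | ∃ (i j l : Fin n) (hij : i ≠ j) (hil : i ≠ l) (hjl : j ≠ l),
      f = av k i l hil * av k j l hjl - av k i j hij * av k j l hjl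
            - av k j i hij.symm * av k i l hil} ∪
  {f | ∃ (i j : Fin n) (hij : i ≠ j) (r : Fin (m - 1)),
      f = pv k i r * pv k j r - av k i j hij * pv k j r - av k j i hij.symm * pv k i r}

/-- The ring `C_{n,m}`. -/
abbrev Cnm (k : Type*) [Field k] (n m : ℕ) :=
  MvPolynomial (CVarT n m) k ⧸ Ideal.span (Crels k n m)

/-- The class of `a_{ij}` in `C_{n,m}`. -/
noncomputable def acl (k : Type*) [Field k] {n m : ℕ} (i j : Fin n) (h : i ≠ j) :
    Cnm k n m :=
  Ideal.Quotient.mk (Ideal.span (Crels k n m)) (av k i j h)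

/-- The class of `p_i^{(r)}` in `C_{n,m}`. -/
noncomputable def pcl (k : Type*) [Field k] {n m : ℕ} (i : Fin n) (r : Fin (m - 1)) :
    Cnm k n m :=
  Ideal.Quotient.mk (Ideal.span (Crels k n m)) (pv k i r)

/-- The weight function giving the `ℕ^n`-grading of `C_{n,m}`:
`deg (a i j) = deg (p i r) = e i`. -/
def wC (n m : ℕ) : CVarT n m → (Fin n → ℕ) :=
  fun v => match v with
  | .inl q => Pi.single q.val.1 1
  | .inr q => Pi.single q.1 1

/-- The degree-`a` graded component of `C_{n,m}`. -/
noncomputable def CComponent (k : Type*) [Field k] (n m : ℕ) (a : Fin n → ℕ) :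
    Submodule k (Cnm k n m) :=
  Submodule.map (Ideal.Quotient.mkₐ k (Ideal.span (Crels k n m))).toLinearMap
    (MvPolynomial.weightedHomogeneousSubmodule k (wC n m) a)

section Statement

variable (k : Type*) [Field k] (n m : ℕ)

/-- The embedding `{1,…,n} ⊆ {1,…,n+m}`. -/
def emb (hnm : n ≤ n + m) : Fin n → Fin (n + m) := Fin.castLE hnm

/-- The index `n + m` (i.e. the last marked point), as an element of `Fin (n+m)`. -/
def lastIdx (h : 0 < n + m) : Fin (n + m) := ⟨n + m - 1, by omega⟩

/-- The index `n + r` for `1 ≤ r ≤ m - 1` (with `r` encoded as the element `r - 1` of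
`Fin (m-1)`), as an element of `Fin (n+m)`; in 0-based indexing it is `n + (r-1)`. -/
def midIdx (r : Fin (m - 1)) : Fin (n + m) := ⟨n + r.val, by omega⟩

/-- The condition that `Φ : C_{n,m} → B_{n+m}` sends `a i j ↦ x̄ i j - x̄ i (n+m)` and
`p i r ↦ x̄ i (n+r) - x̄ i (n+m)`, where on the right-hand side the indices `i, j ∈ {1,…,n}`
are viewed inside `{1,…,n+m}`. -/
def genCond (hnm : 3 ≤ n + m) (Φ : Cnm k n m →ₐ[k] Bring k (n + m)) : Prop :=
  (∀ (i j : Fin n) (h : i ≠ j)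
      (h₁ : emb n m (by omega) i ≠ emb n m (by omega) j)
      (h₂ : emb n m (by omega) i ≠ lastIdx n m (by omega)),
    Φ (acl k i j h) =
      xcl k (emb n m (by omega) i) (emb n m (by omega) j) h₁ -
        xcl k (emb n m (by omega) i) (lastIdx n m (by omega)) h₂) ∧
  (∀ (i : Fin n) (r : Fin (m - 1))
      (h₃ : emb n m (by omega) i ≠ midIdx n m r)
      (h₂ : emb n m (by omega) i ≠ lastIdx n m (by omega)),
    Φ (pcl k i r) =
      xcl k (emb n m (by omega) i) (midIdx n m r) h₃ -
        xcl k (emb n m (by omega) i) (lastIdx n m (by omega)) h₂)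

/-- Extension of a multidegree `a ∈ ℕ^n` to the multidegree `(a,0,…,0) ∈ ℕ^{n+m}`. -/
def extDeg (a : Fin n → ℕ) : Fin (n + m) → ℕ :=
  fun t => if h : (t : ℕ) < n then a ⟨t, h⟩ else 0

end Statement

section PolynomialLemmas

open MvPolynomial

/-- Substituting weighted homogeneous polynomials for the variables turns weighted homogeneous
polynomials into weighted homogeneous ones. -/
theorem isWeightedHomogeneous_aeval {R σ τ M M' : Type*} [CommSemiring R] [AddCommMonoid M]
    [AddCommMonoid M'] {w : σ → M} {w' : τ → M'} (L : M →+ M') {g : σ → MvPolynomial τ R}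
    (hg : ∀ v, IsWeightedHomogeneous w' (g v) (L (w v))) {f : MvPolynomial σ R} {a : M}
    (hf : IsWeightedHomogeneous w f a) : IsWeightedHomogeneous w' (aeval g f) (L a) := by
  classical
  rw [f.as_sum, map_sum]
  refine IsWeightedHomogeneous.sum _ _ _ fun d hd => ?_
  have hd' : Finsupp.weight w d = a := hf (mem_support_iff.mp hd)
  rw [aeval_monomial, algebraMap_eq, ← zero_add (L a)]
  refine (isWeightedHomogeneous_C _ _).mul ?_
  rw [← hd', Finsupp.weight_apply, Finsupp.sum, map_sum]
  refine IsWeightedHomogeneous.prod _ _ _ fun v _ => ?_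
  rw [map_nsmul]
  exact (hg v).pow _

/-- A subalgebra contains the value at `f` of an algebra homomorphism as soon as it contains the
values at all variables occurring in a monomial of `f`. -/
theorem map_mem_of_forall_support {R σ A : Type*} [CommSemiring R] [CommSemiring A]
    [Algebra R A] (S : Subalgebra R A) (φ : MvPolynomial σ R →ₐ[R] A) (f : MvPolynomial σ R)
    (h : ∀ d ∈ f.support, ∀ v ∈ d.support, φ (X v) ∈ S) : φ f ∈ S := by
  rw [f.as_sum, map_sum]
  refine S.sum_mem fun d hd => ?_
  rw [monomial_eq, map_mul, ← algebraMap_eq, AlgHom.commutes, Finsupp.prod, map_prod]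
  refine S.mul_mem (S.algebraMap_mem _) (S.prod_mem fun v hv => ?_)
  rw [map_pow]
  exact S.pow_mem (h d hd v hv) _

end PolynomialLemmas

section Relations

variable {k : Type*} [Field k]

theorem xcl_quadric {N : ℕ} {i j K L : Fin N} (hij : i ≠ j) (hiK : i ≠ K) (hiL : i ≠ L)
    (hjK : j ≠ K) (hjL : j ≠ L) (hKL : K ≠ L) :
    (xcl k i K hiK - xcl k i j hij) * (xcl k j K hjK - xcl k j i hij.symm) =
      (xcl k i L hiL - xcl k i j hij) * (xcl k j L hjL - xcl k j i hij.symm) :=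
  Ideal.Quotient.eq.mpr
    (Ideal.subset_span (Or.inl ⟨i, j, K, L, hij, hiK, hiL, hjK, hjL, hKL, rfl⟩))

theorem xcl_next {N : ℕ} {i : Fin N} (h : i ≠ nextIdx i) : xcl k i (nextIdx i) h = 0 :=
  Ideal.Quotient.eq_zero_iff_mem.mpr (Ideal.subset_span (Or.inr ⟨i, h, rfl⟩))

theorem acl_mul_acl {n m : ℕ} {i j l : Fin n} (hij : i ≠ j) (hil : i ≠ l) (hjl : j ≠ l) :
    (acl k i l hil * acl k j l hjl - acl k i j hij * acl k j l hjl
      - acl k j i hij.symm * acl k i l hil : Cnm k n m) = 0 :=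
  Ideal.Quotient.eq_zero_iff_mem.mpr (Ideal.subset_span (Or.inl ⟨i, j, l, hij, hil, hjl, rfl⟩))

theorem pcl_mul_pcl {n m : ℕ} {i j : Fin n} (hij : i ≠ j) (r : Fin (m - 1)) :
    (pcl k i r * pcl k j r - acl k i j hij * pcl k j r
      - acl k j i hij.symm * pcl k i r : Cnm k n m) = 0 :=
  Ideal.Quotient.eq_zero_iff_mem.mpr (Ideal.subset_span (Or.inr ⟨i, j, hij, r, rfl⟩))

end Relations

section Indices

variable {n m : ℕ}

theorem exists_emb_eq (h : n ≤ n + m) {i : Fin (n + m)} (hi : (i : ℕ) < n) :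
    ∃ i', emb n m h i' = i :=
  ⟨⟨i, hi⟩, rfl⟩

theorem emb_ne_emb {h : n ≤ n + m} {i j : Fin n} (hij : i ≠ j) : emb n m h i ≠ emb n m h j :=
  fun e => hij ((Fin.castLE_injective h) e)

theorem emb_ne_lastIdx (hm : 1 ≤ m) {h : n ≤ n + m} {h' : 0 < n + m} (i : Fin n) :
    emb n m h i ≠ lastIdx n m h' := by
  simp only [emb, lastIdx, ne_eq, Fin.ext_iff, Fin.val_castLE]
  omega

theorem emb_ne_midIdx {h : n ≤ n + m} (i : Fin n) (r : Fin (m - 1)) :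
    emb n m h i ≠ midIdx n m r := by
  simp only [emb, midIdx, ne_eq, Fin.ext_iff, Fin.val_castLE]
  omega

theorem midIdx_ne_lastIdx {h' : 0 < n + m} (r : Fin (m - 1)) :
    midIdx n m r ≠ lastIdx n m h' := by
  simp only [lastIdx, midIdx, ne_eq, Fin.ext_iff]
  omega

theorem ne_nextIdx {N : ℕ} (hN : 2 ≤ N) (i : Fin N) : i ≠ nextIdx i := by
  simp only [nextIdx, ne_eq, Fin.ext_iff]
  rcases Nat.lt_or_ge (i.val + 1) N with h | h
  · rw [Nat.mod_eq_of_lt h]; omega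
  · have : i.val + 1 = N := by omega
    rw [this, Nat.mod_self]; omega

theorem eq_emb_or_midIdx_or_lastIdx (h : n ≤ n + m) (h' : 0 < n + m) (j : Fin (n + m)) :
    (∃ i, j = emb n m h i) ∨ (∃ r, j = midIdx n m r) ∨ j = lastIdx n m h' := by
  by_cases h1 : j.val < n
  · exact Or.inl ⟨⟨j, h1⟩, rfl⟩
  by_cases h2 : j.val - n < m - 1
  · refine Or.inr (Or.inl ⟨⟨j.val - n, h2⟩, Fin.ext ?_⟩)
    simp only [midIdx]
    omega
  · refine Or.inr (Or.inr (Fin.ext ?_))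
    simp only [lastIdx]
    omega

/-- `extDeg` as an additive map. -/
def extDegHom (n m : ℕ) : (Fin n → ℕ) →+ (Fin (n + m) → ℕ) where
  toFun := extDeg n m
  map_zero' := by ext t; simp [extDeg]
  map_add' a b := by ext t; by_cases h : (t : ℕ) < n <;> simp [extDeg, h]

theorem extDeg_single (h : n ≤ n + m) (i : Fin n) :
    extDeg n m (Pi.single i 1) = Pi.single (emb n m h i) 1 := by
  ext t
  by_cases ht : (t : ℕ) < n
  · simp [extDeg, emb, ht, Pi.single_apply, Fin.ext_iff]
  · have : t ≠ Fin.castLE h i := by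
      rintro rfl
      exact ht i.isLt
    simp [extDeg, emb, ht, this]

end Indices

section Maps

open MvPolynomial

variable (k : Type*) [Field k] (n m : ℕ)

/-- The polynomials representing the images of the generators of `C_{n,m}` in `B_{n+m}`. -/
noncomputable def genImage (hm : 1 ≤ m) : CVarT n m → MvPolynomial (BVarT (n + m)) k
  | .inl q => xv k (emb n m (by omega) q.val.1) (emb n m (by omega) q.val.2) (emb_ne_emb q.2) -
      xv k (emb n m (by omega) q.val.1) (lastIdx n m (by omega)) (emb_ne_lastIdx hm _)
  | .inr q => xv k (emb n m (by omega) q.1) (midIdx n m q.2) (emb_ne_midIdx _ _) -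
      xv k (emb n m (by omega) q.1) (lastIdx n m (by omega)) (emb_ne_lastIdx hm _)

/-- The homomorphism `C_{n,m} → B_{n+m}`. -/
noncomputable def phi (hm : 1 ≤ m) : Cnm k n m →ₐ[k] Bring k (n + m) :=
  Ideal.Quotient.liftₐ (Ideal.span (Crels k n m))
    ((Ideal.Quotient.mkₐ k (Ideal.span (Brels k (n + m)))).comp (aeval (genImage k n m hm))) (by
      intro f hf
      refine (Ideal.span_le (I := RingHom.ker _)).mpr ?_ hf
      rintro _ (⟨i, j, l, hij, hil, hjl, rfl⟩ | ⟨i, j, hij, r, rfl⟩)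
      · have key := xcl_quadric (k := k) (N := n + m)
          (emb_ne_emb (h := by omega) hij) (emb_ne_emb hil)
          (emb_ne_lastIdx hm (h' := by omega) i) (emb_ne_emb hjl)
          (emb_ne_lastIdx hm j) (emb_ne_lastIdx hm l)
        simp only [xcl] at key
        simp only [SetLike.mem_coe, RingHom.mem_ker, av, map_sub, map_mul, AlgHom.comp_apply,
          aeval_X, genImage, Ideal.Quotient.mkₐ_eq_mk]
        linear_combination key
      · have key := xcl_quadric (k := k) (N := n + m)
          (emb_ne_emb (h := by omega) hij) (emb_ne_midIdx i r)
          (emb_ne_lastIdx hm (h' := by omega) i) (emb_ne_midIdx j r)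
          (emb_ne_lastIdx hm j) (midIdx_ne_lastIdx r)
        simp only [xcl] at key
        simp only [SetLike.mem_coe, RingHom.mem_ker, av, pv, map_sub, map_mul, AlgHom.comp_apply,
          aeval_X, genImage, Ideal.Quotient.mkₐ_eq_mk]
        linear_combination key)

theorem phi_mk (hm : 1 ≤ m) (f : MvPolynomial (CVarT n m) k) :
    phi k n m hm (Ideal.Quotient.mk _ f) = Ideal.Quotient.mk _ (aeval (genImage k n m hm) f) :=
  rfl

theorem genCond_phi (hm : 1 ≤ m) (hnm : 3 ≤ n + m) : genCond k n m hnm (phi k n m hm) := by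
  constructor
  · intros
    simp [acl, av, phi_mk, genImage, xcl]
  · intros
    simp [pcl, pv, phi_mk, genImage, xcl]

variable {k n m} in
theorem genCond_unique (hm : 1 ≤ m) {hnm : 3 ≤ n + m} {Φ Ψ : Cnm k n m →ₐ[k] Bring k (n + m)}
    (hΦ : genCond k n m hnm Φ) (hΨ : genCond k n m hnm Ψ) : Φ = Ψ := by
  refine Ideal.Quotient.algHom_ext _ (MvPolynomial.algHom_ext fun v => ?_)
  rcases v with ⟨⟨i, j⟩, h⟩ | ⟨i, r⟩
  · exact (hΦ.1 i j h (emb_ne_emb h) (emb_ne_lastIdx hm i)).trans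
      (hΨ.1 i j h (emb_ne_emb h) (emb_ne_lastIdx hm i)).symm
  · exact (hΦ.2 i r (emb_ne_midIdx i r) (emb_ne_lastIdx hm i)).trans
      (hΨ.2 i r (emb_ne_midIdx i r) (emb_ne_lastIdx hm i)).symm

/-- The element of `C_{n,m}` corresponding to `x̄_{ij} - x̄_{i,n+m}`. -/
noncomputable def diffCl (i : Fin n) (j : Fin (n + m)) : Cnm k n m :=
  if h : (j : ℕ) < n then
    if h' : i ≠ ⟨j, h⟩ then acl k i ⟨j, h⟩ h' else 0
  else if h : (j : ℕ) - n < m - 1 then pcl k i ⟨j - n, h⟩ else 0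

variable {n m}

theorem diffCl_emb {h : n ≤ n + m} {i j : Fin n} (hij : i ≠ j) :
    diffCl k n m i (emb n m h j) = acl k i j hij := by
  simp [diffCl, emb, hij]

theorem diffCl_midIdx (i : Fin n) (r : Fin (m - 1)) :
    diffCl k n m i (midIdx n m r) = pcl k i r := by
  simp [diffCl, midIdx]

theorem diffCl_lastIdx (hm : 1 ≤ m) {h : 0 < n + m} (i : Fin n) :
    diffCl k n m i (lastIdx n m h) = 0 := by
  have h1 : ¬ n + m - 1 < n := by omega
  have h2 : ¬ n + m - 1 - n < m - 1 := by omega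
  simp [diffCl, lastIdx, h1, h2]

theorem diffCl_quadric (hm : 1 ≤ m) {h : n ≤ n + m} {i j : Fin n} (hij : i ≠ j)
    {K : Fin (n + m)} (hi : emb n m h i ≠ K) (hj : emb n m h j ≠ K) :
    (diffCl k n m i K - acl k i j hij) * (diffCl k n m j K - acl k j i hij.symm) =
      acl k i j hij * acl k j i hij.symm := by
  rcases eq_emb_or_midIdx_or_lastIdx h (by omega) K with ⟨l, rfl⟩ | ⟨r, rfl⟩ | rfl
  · have hil : i ≠ l := fun e => hi (e ▸ rfl)
    have hjl : j ≠ l := fun e => hj (e ▸ rfl)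
    rw [diffCl_emb k hil, diffCl_emb k hjl]
    linear_combination acl_mul_acl (k := k) (m := m) hij hil hjl
  · rw [diffCl_midIdx, diffCl_midIdx]
    linear_combination pcl_mul_pcl (k := k) hij r
  · rw [diffCl_lastIdx k hm, diffCl_lastIdx k hm]
    ring

/-- The images in `C_{n,m}` of the generators of `B_{n+m}`: the variables of degree `e_i` with
`i > n` are killed, the others are translated so that `x_{i,i+1}` goes to zero. -/
noncomputable def retractImage (v : BVarT (n + m)) : Cnm k n m :=
  if h : (v.val.1 : ℕ) < n then
    diffCl k n m ⟨v.val.1, h⟩ v.val.2 - diffCl k n m ⟨v.val.1, h⟩ (nextIdx v.val.1)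
  else 0

variable (n m) in
/-- A retraction `B_{n+m} → C_{n,m}` of `phi`. -/
noncomputable def retract (hm : 1 ≤ m) : Bring k (n + m) →ₐ[k] Cnm k n m :=
  Ideal.Quotient.liftₐ (Ideal.span (Brels k (n + m))) (aeval (retractImage k)) (by
    intro f hf
    refine (Ideal.span_le (I := RingHom.ker _)).mpr ?_ hf
    rintro _ (⟨i, j, K, L, hij, hiK, hiL, hjK, hjL, hKL, rfl⟩ | ⟨i, hi, rfl⟩)
    · simp only [SetLike.mem_coe, RingHom.mem_ker, xv, map_sub, map_mul, aeval_X]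
      by_cases hi : (i : ℕ) < n
      · by_cases hj : (j : ℕ) < n
        · obtain ⟨i, rfl⟩ := exists_emb_eq (Nat.le_add_right n m) hi
          obtain ⟨j, rfl⟩ := exists_emb_eq (Nat.le_add_right n m) hj
          have hij' : i ≠ j := fun e => hij (e ▸ rfl)
          have hK := diffCl_quadric k hm hij' hiK hjK
          have hL := diffCl_quadric k hm hij' hiL hjL
          rw [← diffCl_emb k (h := by omega) hij', ← diffCl_emb k (h := by omega) hij'.symm]
            at hK hL
          simp only [retractImage, hi, hj, dif_pos]
          simp only [emb, Fin.val_castLE, Fin.eta] at hK hL ⊢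
          linear_combination hK - hL
        · simp [retractImage, hj]
      · simp [retractImage, hi]
    · simp [xv, retractImage])

theorem retract_xcl (hm : 1 ≤ m) {h : n ≤ n + m} (i : Fin n) (j : Fin (n + m))
    (hij : emb n m h i ≠ j) :
    retract k n m hm (xcl k (emb n m h i) j hij) =
      diffCl k n m i j - diffCl k n m i (nextIdx (emb n m h i)) := by
  have : retract k n m hm (xcl k (emb n m h i) j hij) =
      retractImage k ⟨(emb n m h i, j), hij⟩ :=
    aeval_X _ _
  rw [this]
  simp [retractImage, emb]

theorem retract_phi (hm : 1 ≤ m) (hnm : 3 ≤ n + m) :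
    (retract k n m hm).comp (phi k n m hm) = AlgHom.id k _ := by
  have hΦ := genCond_phi k n m hm hnm
  refine Ideal.Quotient.algHom_ext _ (MvPolynomial.algHom_ext fun v => ?_)
  rcases v with ⟨⟨i, j⟩, h⟩ | ⟨i, r⟩
  · change retract k n m hm (phi k n m hm (acl k i j h)) = acl k i j h
    rw [hΦ.1 i j h (emb_ne_emb h) (emb_ne_lastIdx hm i), map_sub, retract_xcl, retract_xcl,
      diffCl_emb k h, diffCl_lastIdx k hm]
    ring
  · change retract k n m hm (phi k n m hm (pcl k i r)) = pcl k i r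
    rw [hΦ.2 i r (emb_ne_midIdx i r) (emb_ne_lastIdx hm i), map_sub, retract_xcl, retract_xcl,
      diffCl_midIdx k, diffCl_lastIdx k hm]
    ring

theorem phi_injective (hm : 1 ≤ m) (hnm : 3 ≤ n + m) : Function.Injective (phi k n m hm) :=
  Function.LeftInverse.injective (g := retract k n m hm)
    fun x => DFunLike.congr_fun (retract_phi k hm hnm) x

theorem isWeightedHomogeneous_genImage (hm : 1 ≤ m) (v : CVarT n m) :
    IsWeightedHomogeneous (wB (n + m)) (genImage k n m hm v) (extDegHom n m (wC n m v)) := by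
  have hX (i : Fin n) (j : Fin (n + m)) (h : emb n m (by omega) i ≠ j) :
      xv k _ j h ∈ weightedHomogeneousSubmodule k (wB (n + m)) (extDeg n m (Pi.single i 1)) := by
    rw [extDeg_single (by omega)]
    exact isWeightedHomogeneous_X k (wB (n + m)) _
  rcases v with ⟨⟨i, j⟩, h⟩ | ⟨i, r⟩
  · exact Submodule.sub_mem _ (hX i _ _) (hX i _ _)
  · exact Submodule.sub_mem _ (hX i _ _) (hX i _ _)

theorem phi_mem_BComponent (hm : 1 ≤ m) {a : Fin n → ℕ} {x : Cnm k n m}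
    (hx : x ∈ CComponent k n m a) :
    phi k n m hm x ∈ BComponent k (n + m) (extDeg n m a) := by
  obtain ⟨f, hf, rfl⟩ := hx
  exact ⟨aeval (genImage k n m hm) f, isWeightedHomogeneous_aeval (extDegHom n m)
    (isWeightedHomogeneous_genImage k hm) hf, rfl⟩

theorem xcl_mem_range_phi (hm : 1 ≤ m) (hnm : 3 ≤ n + m) {i j : Fin (n + m)} (h : i ≠ j)
    (hi : (i : ℕ) < n) : xcl k i j h ∈ (phi k n m hm).range := by
  obtain ⟨i, rfl⟩ := exists_emb_eq (Nat.le_add_right n m) hi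
  have hΦ := genCond_phi k n m hm hnm
  have hlast : emb n m (by omega) i ≠ lastIdx n m (by omega) := emb_ne_lastIdx hm i
  have hdiff (l : Fin (n + m)) (hl : emb n m (by omega) i ≠ l) :
      xcl k _ l hl - xcl k _ _ hlast ∈ (phi k n m hm).range := by
    rcases eq_emb_or_midIdx_or_lastIdx (by omega) (by omega) l with ⟨l, rfl⟩ | ⟨r, rfl⟩ | rfl
    · exact ⟨_, hΦ.1 i l (fun e => hl (e ▸ rfl)) hl hlast⟩
    · exact ⟨_, hΦ.2 i r hl hlast⟩
    · rw [sub_self]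
      exact Subalgebra.zero_mem _
  have hnext := ne_nextIdx (by omega) (emb n m (by omega) i)
  have := Subalgebra.sub_mem _ (hdiff j h) (hdiff _ hnext)
  rwa [xcl_next, sub_sub_sub_cancel_right, sub_zero] at this

theorem range_phi (hm : 1 ≤ m) (hnm : 3 ≤ n + m) :
    Subalgebra.toSubmodule (phi k n m hm).range =
      ⨆ a : Fin n → ℕ, BComponent k (n + m) (extDeg n m a) := by
  apply le_antisymm
  · rintro _ ⟨x, rfl⟩
    obtain ⟨f, rfl⟩ := Ideal.Quotient.mk_surjective x
    change phi k n m hm (Ideal.Quotient.mk _ f) ∈ _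
    rw [f.as_sum, map_sum, map_sum]
    refine Submodule.sum_mem _ fun d _ => Submodule.mem_iSup_of_mem (Finsupp.weight (wC n m) d) ?_
    exact phi_mem_BComponent k hm
      ⟨_, isWeightedHomogeneous_monomial (wC n m) d (coeff d f) rfl, rfl⟩
  · refine iSup_le fun a => ?_
    rintro _ ⟨f, hf, rfl⟩
    refine map_mem_of_forall_support _ (Ideal.Quotient.mkₐ k _) f fun d hd v hv =>
      xcl_mem_range_phi k hm hnm v.2 ?_
    by_contra hlt
    have hdeg : Finsupp.weight (wB (n + m)) d v.val.1 = 0 := by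
      rw [hf (mem_support_iff.mp hd)]
      simp [extDeg, hlt]
    rw [Finsupp.weight_apply, Finsupp.sum, Finset.sum_apply, Finset.sum_eq_zero_iff] at hdeg
    have := hdeg v hv
    simp only [wB, Pi.smul_apply, Pi.single_eq_same, smul_eq_mul, mul_one] at this
    exact Finsupp.mem_support_iff.mp hv this

end Maps

section Statement

variable (k : Type*) [Field k] (n m : ℕ)

/-- Lemma 2.2 of the paper: for `n ≥ 2`, `m ≥ 1` (so `n + m ≥ 3`), there
is a unique `k`-algebra homomorphism `Φ : C_{n,m} → B_{n+m}` with
`Φ (a i j) = x̄ i j - x̄ i (n+m)` and `Φ (p i r) = x̄ i (n+r) - x̄ i (n+m)`; moreover `Φ` is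
injective, maps the degree-`a` component of `C_{n,m}` into the degree-`(a,0,…,0)` component
of `B_{n+m}`, and its image is exactly the subalgebra `B_{n,m} ⊆ B_{n+m}`, the sum of the
graded components of `B_{n+m}` of degrees in `ℕe₁ + ⋯ + ℕeₙ`. -/
theorem Cnm_embeds_in_B (hn : 2 ≤ n) (hm : 1 ≤ m) (hnm : 3 ≤ n + m) :
    (∃! Φ : Cnm k n m →ₐ[k] Bring k (n + m), genCond k n m hnm Φ) ∧
    ∀ Φ : Cnm k n m →ₐ[k] Bring k (n + m), genCond k n m hnm Φ →
      Function.Injective Φ ∧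
      (∀ (a : Fin n → ℕ), ∀ x ∈ CComponent k n m a,
        Φ x ∈ BComponent k (n + m) (extDeg n m a)) ∧
      ((Φ.range : Set (Bring k (n + m))) =
        ((⨆ a : Fin n → ℕ, BComponent k (n + m) (extDeg n m a)) :
          Submodule k (Bring k (n + m)))) := by
  have hΦ := genCond_phi k n m hm hnm
  refine ⟨⟨_, hΦ, fun Ψ hΨ => genCond_unique hm hΨ hΦ⟩, fun Ψ hΨ => ?_⟩
  obtain rfl := genCond_unique hm hΨ hΦ
  exact ⟨phi_injective k hm hnm, fun a x hx => phi_mem_BComponent k hm hx,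
    congrArg SetLike.coe (range_phi k hm hnm)⟩

end Statement
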